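/- Let f_n : {0,1}^{3^n} → {0,1} be the iterated 3-majority function of depth n, and let {p_n} be any sequence in [0,1] bounded away from 0 and 1. Then {f_n} is noise sensitive with respect to {p_n}. -/

import Mathlib

open MeasureTheory

/-- The Bernoulli(p) measure on `Bool` (probability `p` of `true`). -/
noncomputable def bern (p : ℝ) : Measure Bool :=
  ENNReal.ofReal p • Measure.dirac true + ENNReal.ofReal (1 - p) • Measure.dirac false

/-- Joint law of (ω_i, fresh bit, resample indicator) per coordinate. -/
noncomputable def noiseμ (m : ℕ) (p ε : ℝ) : Measure (Fin m → Bool × Bool × Bool) :=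
  Measure.pi fun _ => (bern p).prod ((bern p).prod (bern ε))

/-- The original configuration ω. -/
def obs {m : ℕ} (σ : Fin m → Bool × Bool × Bool) : Fin m → Bool := fun i => (σ i).1

/-- The noised configuration ω^ε. -/
def pert {m : ℕ} (σ : Fin m → Bool × Bool × Bool) : Fin m → Bool :=
  fun i => if (σ i).2.2 then (σ i).2.1 else (σ i).1

/-- A Boolean as a real number. -/
noncomputable def bval (b : Bool) : ℝ := if b then 1 else 0

/-- Majority of three Booleans. -/
def maj3 (a b c : Bool) : Bool := (a && b) || ((a && c) || (b && c))

/-- The iterated 3-majority function on the `3^n` leaves of the rooted ternary tree of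
depth `n`: each internal vertex takes the majority of its three children. -/
def iter3maj : (n : ℕ) → (Fin (3^n) → Bool) → Bool
  | 0, x => x ⟨0, by norm_num⟩
  | n+1, x =>
    maj3
      (iter3maj n (fun i => x ⟨i.1, by
        have hi := i.isLt
        have h3 : (3:ℕ)^(n+1) = 3 * 3^n := by rw [pow_succ]; ring
        omega⟩))
      (iter3maj n (fun i => x ⟨3^n + i.1, by
        have hi := i.isLt
        have h3 : (3:ℕ)^(n+1) = 3 * 3^n := by rw [pow_succ]; ring
        omega⟩))
      (iter3maj n (fun i => x ⟨2 * 3^n + i.1, by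
        have hi := i.isLt
        have h3 : (3:ℕ)^(n+1) = 3 * 3^n := by rw [pow_succ]; ring
        omega⟩))

theorem integral_bern {p : ℝ} (h0 : 0 ≤ p) (h1 : p ≤ 1) (f : Bool → ℝ) :
    ∫ b, f b ∂(bern p) = p * f true + (1 - p) * f false := by
  have h1' : 0 ≤ 1 - p := by linarith
  unfold bern
  rw [integral_add_measure, integral_smul_measure, integral_smul_measure, integral_dirac,
    integral_dirac, ENNReal.toReal_ofReal h0, ENNReal.toReal_ofReal h1', smul_eq_mul, smul_eq_mul]
  · exact (integrable_dirac (by simp)).smul_measure ENNReal.ofReal_ne_top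
  · exact (integrable_dirac (by simp)).smul_measure ENNReal.ofReal_ne_top

theorem isProbabilityMeasure_bern {p : ℝ} (h0 : 0 ≤ p) (h1 : p ≤ 1) :
    IsProbabilityMeasure (bern p) := by
  constructor
  simp only [bern, Measure.coe_add, Measure.coe_smul, Pi.add_apply, Pi.smul_apply, measure_univ,
    smul_eq_mul, mul_one]
  rw [← ENNReal.ofReal_add h0 (by linarith)]
  simp

/-- The sub-configuration of `Fin (3 ^ (n + 1)) → α` read on the block starting at `k * 3 ^ n`. -/
def block {α : Type*} (n : ℕ) (k : Fin 3) (x : Fin (3 ^ (n + 1)) → α) : Fin (3 ^ n) → α :=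
  fun i => x ⟨k * 3 ^ n + i, by
    have hi := i.isLt
    have h3 : (3 : ℕ) ^ (n + 1) = 3 * 3 ^ n := by rw [pow_succ]; ring
    have hk : (k : ℕ) * 3 ^ n ≤ 2 * 3 ^ n := Nat.mul_le_mul_right _ (by omega)
    omega⟩

theorem iter3maj_succ (n : ℕ) (x : Fin (3 ^ (n + 1)) → Bool) :
    iter3maj (n + 1) x =
      maj3 (iter3maj n (block n 0 x)) (iter3maj n (block n 1 x)) (iter3maj n (block n 2 x)) := by
  simp only [iter3maj]
  congr <;> funext i <;> simp [block]

theorem prod_fin_three_pow_succ {M : Type*} [CommMonoid M] (n : ℕ) (g : Fin (3 ^ (n + 1)) → M) :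
    ∏ i, g i = (∏ i, block n 0 g i) * ((∏ i, block n 1 g i) * ∏ i, block n 2 g i) := by
  have h3 : 3 ^ n + (3 ^ n + 3 ^ n) = 3 ^ (n + 1) := by rw [pow_succ]; ring
  rw [← (finCongr h3).prod_comp g, Fin.prod_univ_add, Fin.prod_univ_add]
  congr 1
  · exact Finset.prod_congr rfl fun i _ => congrArg g (Fin.ext (by simp))
  congr 1
  · exact Finset.prod_congr rfl fun i _ => congrArg g (Fin.ext (by simp))
  · exact Finset.prod_congr rfl fun i _ => congrArg g (Fin.ext (by simp; ring))

theorem block_ext {α : Type*} {n : ℕ} {x y : Fin (3 ^ (n + 1)) → α}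
    (h : ∀ k, block n k x = block n k y) : x = y := by
  have h3 : 3 * 3 ^ n = 3 ^ (n + 1) := by rw [pow_succ]; ring
  funext i
  have hi : (i : ℕ) < 3 * 3 ^ n := i.isLt.trans_eq h3.symm
  have hpos : 0 < 3 ^ n := by positivity
  have := congrFun (h ⟨i / 3 ^ n, (Nat.div_lt_iff_lt_mul hpos).2 hi⟩)
    ⟨i % 3 ^ n, Nat.mod_lt _ hpos⟩
  simpa [block, Nat.div_add_mod'] using this

theorem map_blocks_pi {α : Type*} [Fintype α] [MeasurableSpace α] [MeasurableSingletonClass α]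
    (μ : Measure α) [IsProbabilityMeasure μ] (n : ℕ) :
    (Measure.pi fun _ : Fin (3 ^ (n + 1)) => μ).map
        (fun σ => (block n 0 σ, block n 1 σ, block n 2 σ)) =
      (Measure.pi fun _ : Fin (3 ^ n) => μ).prod
        ((Measure.pi fun _ : Fin (3 ^ n) => μ).prod (Measure.pi fun _ : Fin (3 ^ n) => μ)) := by
  have hinj : Function.Injective
      (fun σ : Fin (3 ^ (n + 1)) → α => (block n 0 σ, block n 1 σ, block n 2 σ)) := by
    intro x y h
    simp only [Prod.mk.injEq] at h
    refine block_ext fun k => ?_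
    fin_cases k
    exacts [h.1, h.2.1, h.2.2]
  have hcard : Fintype.card (Fin (3 ^ (n + 1)) → α) =
      Fintype.card ((Fin (3 ^ n) → α) × (Fin (3 ^ n) → α) × (Fin (3 ^ n) → α)) := by
    simp only [Fintype.card_prod, Fintype.card_fun, Fintype.card_fin]
    ring
  have hsurj := ((Fintype.bijective_iff_injective_and_card _).2 ⟨hinj, hcard⟩).2
  refine Measure.ext_of_singleton fun τ => ?_
  obtain ⟨σ, rfl⟩ := hsurj τ
  rw [Measure.map_apply (measurable_of_finite _) (measurableSet_singleton _)]
  have hpre := hinj.preimage_image {σ}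
  rw [Set.image_singleton] at hpre
  rw [hpre]
  simp only [← Set.singleton_prod_singleton, Measure.prod_prod,
    Measure.pi_singleton]
  exact prod_fin_three_pow_succ n fun i => μ {σ i}

/-- The law of a pair of bits with masses `A` on `(1,1)`, `B` on each of `(1,0)` and `(0,1)`, and
`D` on `(0,0)`, integrated against `h`. -/
def pairExp (A B D : ℝ) (h : Bool → Bool → ℝ) : ℝ :=
  A * h true true + B * h true false + B * h false true + D * h false false

theorem integral_iter3maj_succ {n : ℕ} {p ε A B D : ℝ} (hp0 : 0 ≤ p) (hp1 : p ≤ 1) (hε0 : 0 ≤ ε)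
    (hε1 : ε ≤ 1)
    (hlaw : ∀ h : Bool → Bool → ℝ,
      ∫ σ, h (iter3maj n (obs σ)) (iter3maj n (pert σ)) ∂(noiseμ (3 ^ n) p ε) = pairExp A B D h)
    (h : Bool → Bool → ℝ) :
    ∫ σ, h (iter3maj (n + 1) (obs σ)) (iter3maj (n + 1) (pert σ)) ∂(noiseμ (3 ^ (n + 1)) p ε) =
      pairExp A B D fun a a' => pairExp A B D fun b b' => pairExp A B D fun c c' =>
        h (maj3 a b c) (maj3 a' b' c') := by
  have := isProbabilityMeasure_bern hp0 hp1
  have := isProbabilityMeasure_bern hε0 hε1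
  let F :=
      (fun τ : (Fin (3 ^ n) → Bool × Bool × Bool) × (Fin (3 ^ n) → Bool × Bool × Bool) ×
          (Fin (3 ^ n) → Bool × Bool × Bool) =>
        h (maj3 (iter3maj n (obs τ.1)) (iter3maj n (obs τ.2.1)) (iter3maj n (obs τ.2.2)))
          (maj3 (iter3maj n (pert τ.1)) (iter3maj n (pert τ.2.1)) (iter3maj n (pert τ.2.2))))
  have hprod : ∀ σ : Fin (3 ^ (n + 1)) → Bool × Bool × Bool,
      h (iter3maj (n + 1) (obs σ)) (iter3maj (n + 1) (pert σ)) =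
        F (block n 0 σ, block n 1 σ, block n 2 σ) := by
    intro σ
    simp only [iter3maj_succ]
    rfl
  unfold noiseμ at hlaw ⊢
  rw [integral_congr_ae (.of_forall hprod), ← integral_map (f := F) (Measurable.of_discrete.aemeasurable) (by fun_prop), map_blocks_pi,
    integral_prod _ .of_finite]
  simp_rw [integral_prod _ (Integrable.of_finite)]
  rw [← hlaw]
  congr 1; funext x
  rw [← hlaw]
  congr 1; funext y
  rw [← hlaw]

theorem integral_iter3maj_zero {p ε : ℝ} (hp0 : 0 ≤ p) (hp1 : p ≤ 1) (hε0 : 0 ≤ ε)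
    (hε1 : ε ≤ 1) (h : Bool → Bool → ℝ) :
    ∫ σ, h (iter3maj 0 (obs σ)) (iter3maj 0 (pert σ)) ∂(noiseμ (3 ^ 0) p ε) =
      pairExp (p * (1 - ε * (1 - p))) (ε * (p * (1 - p))) ((1 - p) * (1 - ε * p)) h := by
  have := isProbabilityMeasure_bern hp0 hp1
  have := isProbabilityMeasure_bern hε0 hε1
  have hev := (measurePreserving_eval
    (fun _ : Fin (3 ^ 0) => (bern p).prod ((bern p).prod (bern ε))) ⟨0, by norm_num⟩).map_eq
  let F := fun a : Bool × Bool × Bool => h a.1 (if a.2.2 then a.2.1 else a.1)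
  have key : ∀ σ : Fin (3 ^ 0) → Bool × Bool × Bool,
      h (iter3maj 0 (obs σ)) (iter3maj 0 (pert σ)) =
        F (Function.eval ⟨0, by norm_num⟩ σ) := fun σ => rfl
  unfold noiseμ
  rw [integral_congr_ae (.of_forall key), ← integral_map (f := F) (Measurable.of_discrete.aemeasurable) (by fun_prop), hev,
    integral_prod _ .of_finite]
  simp_rw [integral_prod _ (Integrable.of_finite), integral_bern hp0 hp1, integral_bern hε0 hε1]
  simp only [if_true, Bool.false_eq_true, if_false, pairExp, F]
  ring

/-- One level of majority contracts the correlation: if the covariance `c` is at most `t` times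
the variance `V`, the covariance one level up is at most `t * (1 - ε / 4)` times the variance. -/
theorem covariance_step {V c t ε : ℝ} (hV0 : 0 ≤ V) (hV1 : V ≤ 1 / 4) (hc0 : 0 ≤ c) (ht0 : 0 ≤ t)
    (ht1 : t ≤ 1 - ε) (hε : 0 ≤ ε) (hct : c ≤ t * V) :
    12 * V ^ 2 * c + 3 * (1 - 4 * V) * c ^ 2 + 4 * c ^ 3 ≤
      t * (1 - ε / 4) * (3 * V ^ 2 + 4 * V ^ 3) := by
  have h4 : 0 ≤ 1 - 4 * V := by linarith
  calc 12 * V ^ 2 * c + 3 * (1 - 4 * V) * c ^ 2 + 4 * c ^ 3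
      ≤ 12 * V ^ 2 * (t * V) + 3 * (1 - 4 * V) * (t * V) ^ 2 + 4 * (t * V) ^ 3 := by gcongr
    _ = t * V ^ 2 * (3 + 4 * V - (1 - t) * (3 - 4 * V * (2 - t))) := by ring
    _ ≤ t * V ^ 2 * ((1 - ε / 4) * (3 + 4 * V)) := by
        gcongr
        have h1 : ε * 1 ≤ (1 - t) * (3 - 4 * V * (2 - t)) := by
          gcongr
          · linarith
          · linarith
          · nlinarith
        nlinarith
    _ = t * (1 - ε / 4) * (3 * V ^ 2 + 4 * V ^ 3) := by ring

theorem exists_pairLaw {p ε : ℝ} (hp0 : 0 ≤ p) (hp1 : p ≤ 1) (hε0 : 0 ≤ ε) (hε1 : ε ≤ 1) (n : ℕ) :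
    ∃ A B D : ℝ, A + 2 * B + D = 1 ∧ 0 ≤ (A + B) * (B + D) ∧ 0 ≤ A * D - B ^ 2 ∧
      A * D - B ^ 2 ≤ (1 - ε) * (1 - ε / 4) ^ n * ((A + B) * (B + D)) ∧
      ∀ h : Bool → Bool → ℝ,
        ∫ σ, h (iter3maj n (obs σ)) (iter3maj n (pert σ)) ∂(noiseμ (3 ^ n) p ε) =
          pairExp A B D h := by
  have hε1' : 0 ≤ 1 - ε := by linarith
  have hp1' : 0 ≤ 1 - p := by linarith
  induction n with
  | zero =>
    refine ⟨_, _, _, by ring, ?_, ?_, ?_, integral_iter3maj_zero hp0 hp1 hε0 hε1⟩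
    · have : 0 ≤ p * (1 - p) := by positivity
      linarith
    · have : 0 ≤ (1 - ε) * (p * (1 - p)) := by positivity
      linarith
    · apply le_of_eq
      ring
  | succ n ih =>
    obtain ⟨A, B, D, hsum, hV, hc0, hct, hlaw⟩ := ih
    obtain rfl : D = 1 - A - 2 * B := by linarith
    have hq : 1 / 4 - (A + B) * (B + (1 - A - 2 * B)) = (A + B - 1 / 2) ^ 2 := by ring
    have hV1 : (A + B) * (B + (1 - A - 2 * B)) ≤ 1 / 4 := by nlinarith [sq_nonneg (A + B - 1 / 2)]
    have hpow0 : 0 ≤ (1 - ε / 4) ^ n := pow_nonneg (by linarith) n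
    have hpow1 : (1 - ε / 4) ^ n ≤ 1 := pow_le_one₀ (by linarith) (by linarith)
    have hstep := covariance_step hV hV1 hc0 (mul_nonneg hε1' hpow0)
      (mul_le_of_le_one_right hε1' hpow1) hε0 hct
    generalize hVdef : (A + B) * (B + (1 - A - 2 * B)) = V at *
    generalize hcdef : A * (1 - A - 2 * B) - B ^ 2 = c at *
    have hA : A = (A + B) ^ 2 + c := by rw [← hcdef]; ring
    have hV' : (3 * (A + B) ^ 2 - 2 * (A + B) ^ 3) * (1 - (3 * (A + B) ^ 2 - 2 * (A + B) ^ 3)) =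
        3 * V ^ 2 + 4 * V ^ 3 := by rw [← hVdef]; ring
    have hc' : A ^ 3 + 3 * A ^ 2 * (1 - A) + 6 * A * B ^ 2 - (3 * (A + B) ^ 2 - 2 * (A + B) ^ 3) ^ 2 =
        12 * V ^ 2 * c + 3 * (1 - 4 * V) * c ^ 2 + 4 * c ^ 3 := by
      rw [← hVdef, ← hcdef]; ring
    refine ⟨A ^ 3 + 3 * A ^ 2 * (1 - A) + 6 * A * B ^ 2,
      3 * (A + B) ^ 2 - 2 * (A + B) ^ 3 - (A ^ 3 + 3 * A ^ 2 * (1 - A) + 6 * A * B ^ 2),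
      1 - 2 * (3 * (A + B) ^ 2 - 2 * (A + B) ^ 3) + (A ^ 3 + 3 * A ^ 2 * (1 - A) + 6 * A * B ^ 2),
      by ring, ?_, ?_, ?_, fun h => ?_⟩
    · have : 0 ≤ 3 * V ^ 2 + 4 * V ^ 3 := by positivity
      linarith
    · have h4 : 0 ≤ 1 - 4 * V := by linarith
      have : 0 ≤ 12 * V ^ 2 * c + 3 * (1 - 4 * V) * c ^ 2 + 4 * c ^ 3 := by positivity
      linarith
    · rw [pow_succ]
      calc _ = 12 * V ^ 2 * c + 3 * (1 - 4 * V) * c ^ 2 + 4 * c ^ 3 := by rw [← hc']; ring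
        _ ≤ _ := hstep
        _ = _ := by rw [← hV']; ring
    · rw [integral_iter3maj_succ hp0 hp1 hε0 hε1 hlaw h]
      simp only [pairExp, maj3, Bool.and_true, Bool.and_false, Bool.or_true, Bool.or_false,
        Bool.or_self]
      ring

/-- the iterated 3-majority functions are noise sensitive with respect to
any sequence {p_n} bounded away from 0 and 1: for every ε > 0,
E[f_n(ω_n)f_n(ω_n^ε)] − E[f_n(ω_n)]² → 0. -/
theorem stmt_5 (p : ℕ → ℝ) (δ : ℝ) (hδ : 0 < δ) (hp : ∀ n, δ ≤ p n ∧ p n ≤ 1 - δ) :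
    ∀ ε : ℝ, 0 < ε → ε ≤ 1 →
      Filter.Tendsto (fun n =>
        (∫ σ, bval (iter3maj n (obs σ)) * bval (iter3maj n (pert σ))
            ∂(noiseμ (3^n) (p n) ε)) -
        (∫ σ, bval (iter3maj n (obs σ)) ∂(noiseμ (3^n) (p n) ε)) ^ 2)
      Filter.atTop (nhds 0) := by
  intro ε hε0 hε1
  have hlim : Filter.Tendsto (fun n : ℕ => (1 - ε / 4) ^ n) Filter.atTop (nhds 0) :=
    tendsto_pow_atTop_nhds_zero_of_lt_one (by linarith) (by linarith)
  refine squeeze_zero' (Filter.Eventually.of_forall fun n => ?_)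
    (Filter.Eventually.of_forall fun n => ?_) hlim <;>
  · obtain ⟨A, B, D, hsum, hV, hc0, hct, hlaw⟩ := exists_pairLaw (p := p n)
      (by linarith [hp n]) (by linarith [hp n]) hε0.le hε1 n
    have hpow : 0 ≤ (1 - ε / 4) ^ n := pow_nonneg (by linarith) n
    rw [hlaw fun a b => bval a * bval b, hlaw fun a _ => bval a]
    obtain rfl : D = 1 - A - 2 * B := by linarith
    have hV1 : (A + B) * (B + (1 - A - 2 * B)) ≤ 1 := by nlinarith [sq_nonneg (A + B - 1 / 2)]
    have hb : (1 - ε) * (1 - ε / 4) ^ n * ((A + B) * (B + (1 - A - 2 * B))) ≤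
        1 * (1 - ε / 4) ^ n * 1 := by
      gcongr
      linarith
    simp only [pairExp, bval, if_true, Bool.false_eq_true, if_false]
    linarith
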